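/- Let η be a sigmoidal function satisfying (P1)–(P3) and η(1) < 1, let σ_η(s) := (η(s+1) - η(s-1))/2, and for d ≥ 1 let σ(s) := ∏_{i=1}^d σ_η(s_i). Then for every δ > 0, sup_{s∈ℝ^d} ∑_{k∈ℤ^d, ‖ns-k‖ > nδ} σ(ns-k) → 0 as n → ∞ (multivariate localization property). -/

import Mathlib

open Filter Asymptotics MeasureTheory

/-- The activation function `σ_η(s) = (η(s+1) - η(s-1))/2`. -/
noncomputable def act (η : ℝ → ℝ) (s : ℝ) : ℝ := (η (s + 1) - η (s - 1)) / 2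

/-- The multivariate activation `σ(s) = ∏ i, σ_η(s i)`. -/
noncomputable def actM (η : ℝ → ℝ) {d : ℕ} (s : Fin d → ℝ) : ℝ := ∏ i, act η (s i)

/-- The index set `Λ_n = {k : ℤ^d | ⌈n aᵢ⌉ ≤ kᵢ ≤ ⌊n bᵢ⌋}`. -/
noncomputable def Lam {d : ℕ} (a b : Fin d → ℝ) (n : ℕ) : Finset (Fin d → ℤ) :=
  Fintype.piFinset fun i => Finset.Icc ⌈(n : ℝ) * a i⌉ ⌊(n : ℝ) * b i⌋

/-- Interpret a vector of coordinates as a point of Euclidean space. -/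
noncomputable def toEuc {d : ℕ} (x : Fin d → ℝ) : EuclideanSpace ℝ (Fin d) :=
  (WithLp.equiv 2 (Fin d → ℝ)).symm x

/-- The multivariate Stancu-type neural network operator `F_n^{(α,β)}(f; s)`. -/
noncomputable def stancuOp (η : ℝ → ℝ) {d : ℕ} (a b : Fin d → ℝ) (α β : ℝ) (n : ℕ)
    (f : EuclideanSpace ℝ (Fin d) → ℝ) (s : EuclideanSpace ℝ (Fin d)) : ℝ :=
  (∑ k ∈ Lam a b n, actM η (fun i => (n : ℝ) * s i - (k i : ℝ)) *
      f (toEuc fun i => ((k i : ℝ) + α) / ((n : ℝ) + β))) /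
  ∑ k ∈ Lam a b n, actM η (fun i => (n : ℝ) * s i - (k i : ℝ))

theorem act_nonneg_aux {η : ℝ → ℝ} (hm : Monotone η) (s : ℝ) : 0 ≤ act η s := by
  have := hm (show s - 1 ≤ s + 1 by linarith)
  unfold act
  linarith

theorem act_tel_aux (η : ℝ → ℝ) (x : ℝ) (a : ℤ) (m : ℕ) :
    ∑ j ∈ Finset.range m, act η (x - ((a + (j : ℤ) : ℤ) : ℝ)) =
      (η (x - a + 1) + η (x - a) - η (x - a - m + 1) - η (x - a - m)) / 2 := by
  induction m with
  | zero => simp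
  | succ m ih =>
    rw [Finset.sum_range_succ, ih]
    unfold act
    push_cast
    rw [show x - (a + (m : ℝ)) + 1 = x - a - m + 1 by ring,
      show x - (a + (m : ℝ)) - 1 = x - a - (m + 1) by ring,
      show x - a - ((m : ℝ) + 1) + 1 = x - a - m by ring]
    ring

theorem act_sum_aux {η : ℝ → ℝ} (hm : Monotone η) (x : ℝ) (a b : ℤ) (hab : a ≤ b)
    (S : Finset ℤ) (hS : ∀ k ∈ S, a ≤ k ∧ k ≤ b) :
    ∑ k ∈ S, act η (x - (k : ℝ)) ≤ η (x - a + 1) - η (x - b - 1) := by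
  obtain ⟨m, hmm⟩ : ∃ m : ℕ, b = a + m := ⟨(b - a).toNat, by omega⟩
  have h1 : S ⊆ (Finset.range (m + 1)).image (fun j : ℕ => a + (j : ℤ)) := by
    intro k hk
    obtain ⟨h1, h2⟩ := hS k hk
    rw [Finset.mem_image]
    exact ⟨(k - a).toNat, by rw [Finset.mem_range]; omega, by omega⟩
  have h2 := Finset.sum_le_sum_of_subset_of_nonneg h1
    (f := fun k : ℤ => act η (x - (k : ℝ))) (fun k _ _ => act_nonneg_aux hm _)
  rw [Finset.sum_image (by intro p _ q _ h; simpa using h)] at h2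
  have h3 := act_tel_aux η x a (m + 1)
  have h4 := hm (show x - (a : ℝ) ≤ x - a + 1 by linarith)
  have h5 := hm (show x - (b : ℝ) - 1 ≤ x - a - ((m + 1 : ℕ) : ℝ) + 1 by
    rw [hmm]; push_cast; linarith)
  have h6 := hm (show x - (b : ℝ) - 1 ≤ x - a - ((m + 1 : ℕ) : ℝ) by
    rw [hmm]; push_cast; linarith)
  linarith

theorem act_sum_le_one_aux {η : ℝ → ℝ} (hm : Monotone η) (h0 : ∀ x, 0 ≤ η x)
    (h1 : ∀ x, η x ≤ 1) (x : ℝ) (S : Finset ℤ) : ∑ k ∈ S, act η (x - (k : ℝ)) ≤ 1 := by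
  rcases S.eq_empty_or_nonempty with rfl | hne
  · simp
  · have := act_sum_aux hm x (S.min' hne) (S.max' hne) (S.min'_le _ (S.max'_mem hne)) S
      (fun k hk => ⟨S.min'_le _ hk, S.le_max' _ hk⟩)
    have h2 := h1 (x - (S.min' hne) + 1)
    have h3 := h0 (x - (S.max' hne) - 1)
    linarith

theorem act_sum_tail_aux {η : ℝ → ℝ} (hm : Monotone η) (h0 : ∀ x, 0 ≤ η x)
    (h1 : ∀ x, η x ≤ 1) (x R : ℝ) (S : Finset ℤ) :
    ∑ k ∈ S with R < |x - (k : ℤ)|, act η (x - (k : ℝ)) ≤ η (1 - R) + (1 - η (R - 1)) := by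
  have hsplit : ∑ k ∈ S with R < |x - (k : ℤ)|, act η (x - (k : ℝ)) ≤
      ∑ k ∈ S with x - ((k : ℤ) : ℝ) < -R, act η (x - (k : ℝ)) +
      ∑ k ∈ S with R < x - ((k : ℤ) : ℝ), act η (x - (k : ℝ)) := by
    simp only [Finset.sum_filter]
    rw [← Finset.sum_add_distrib]
    apply Finset.sum_le_sum
    intro k _
    have hk := act_nonneg_aux hm (x - (k : ℝ))
    by_cases h : R < |x - (k : ℝ)|
    · rw [if_pos h]
      rcases lt_abs.1 h with h | h
      · rw [if_pos h]
        split_ifs <;> linarith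
      · rw [if_pos (show x - (k : ℝ) < -R by linarith)]
        split_ifs <;> linarith
    · rw [if_neg h]
      split_ifs <;> linarith
  have hA : ∑ k ∈ S with x - ((k : ℤ) : ℝ) < -R, act η (x - (k : ℝ)) ≤ η (1 - R) := by
    set T := S.filter (fun k : ℤ => x - (k : ℝ) < -R) with hT
    rcases T.eq_empty_or_nonempty with he | hne
    · rw [he]; simpa using h0 _
    · have := act_sum_aux hm x (T.min' hne) (T.max' hne) (T.min'_le _ (T.max'_mem hne)) T
        (fun k hk => ⟨T.min'_le _ hk, T.le_max' _ hk⟩)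
      have h2 := (Finset.mem_filter.1 (T.min'_mem hne)).2
      have h4 := hm (show x - ((T.min' hne : ℤ) : ℝ) + 1 ≤ 1 - R by linarith)
      have h3 := h0 (x - (T.max' hne) - 1)
      linarith
  have hB : ∑ k ∈ S with R < x - ((k : ℤ) : ℝ), act η (x - (k : ℝ)) ≤ 1 - η (R - 1) := by
    set T := S.filter (fun k : ℤ => R < x - (k : ℝ)) with hT
    rcases T.eq_empty_or_nonempty with he | hne
    · rw [he]; simpa using h1 _
    · have := act_sum_aux hm x (T.min' hne) (T.max' hne) (T.min'_le _ (T.max'_mem hne)) T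
        (fun k hk => ⟨T.min'_le _ hk, T.le_max' _ hk⟩)
      have h2 := (Finset.mem_filter.1 (T.max'_mem hne)).2
      have h4 := hm (show R - 1 ≤ x - ((T.max' hne : ℤ) : ℝ) - 1 by linarith)
      have h3 := h1 (x - (T.min' hne) + 1)
      linarith
  linarith

theorem actM_nonneg_aux {η : ℝ → ℝ} (hm : Monotone η) {d : ℕ} (s : Fin d → ℝ) :
    0 ≤ actM η s :=
  Finset.prod_nonneg (fun _ _ => act_nonneg_aux hm _)

theorem exists_coord_aux {d : ℕ} (hd : 1 ≤ d) (v : Fin d → ℝ) (r : ℝ) (h : r < ‖toEuc v‖) :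
    ∃ i, r / d < |v i| := by
  by_contra! hc
  have hd' : (0 : ℝ) < d := by exact_mod_cast hd
  have h1 : ‖toEuc v‖ ≤ ∑ i, |v i| := by
    rw [EuclideanSpace.norm_eq]
    apply Real.sqrt_le_iff.2
    refine ⟨Finset.sum_nonneg fun i _ => abs_nonneg _, ?_⟩
    have := Finset.sum_sq_le_sq_sum_of_nonneg (s := Finset.univ) (f := fun i => |v i|)
      (fun i _ => abs_nonneg _)
    simpa [toEuc] using this
  have h2 : ∑ i, |v i| ≤ ∑ _i : Fin d, r / d := Finset.sum_le_sum fun i _ => hc i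
  simp only [Finset.sum_const, Finset.card_univ, Fintype.card_fin, nsmul_eq_mul] at h2
  rw [mul_div_cancel₀ _ hd'.ne'] at h2
  linarith

theorem actM_sum_aux {η : ℝ → ℝ} (hm : Monotone η) (h0 : ∀ x, 0 ≤ η x)
    (h1 : ∀ x, η x ≤ 1) {d : ℕ} (x : Fin d → ℝ) (R : ℝ)
    (F : Finset (Fin d → ℤ)) (hF : ∀ k ∈ F, ∃ i, R < |x i - (k i : ℝ)|) :
    ∑ k ∈ F, actM η (fun i => x i - (k i : ℝ)) ≤ d * (η (1 - R) + (1 - η (R - 1))) := by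
  classical
  set S : Fin d → Finset ℤ := fun i => F.image (fun k => k i) with hS
  set T : Fin d → Fin d → Finset ℤ := fun i j =>
    if j = i then (S j).filter (fun k : ℤ => R < |x j - (k : ℝ)|) else S j with hT
  have hsub : F ⊆ Finset.univ.biUnion (fun i => Fintype.piFinset (T i)) := by
    intro k hk
    obtain ⟨i, hi⟩ := hF k hk
    refine Finset.mem_biUnion.2 ⟨i, Finset.mem_univ _, Fintype.mem_piFinset.2 fun j => ?_⟩
    have hj : k j ∈ S j := Finset.mem_image_of_mem (fun k : Fin d → ℤ => k j) hk
    by_cases hji : j = i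
    · subst hji
      simp only [hT, if_true]
      exact Finset.mem_filter.2 ⟨hj, hi⟩
    · simp only [hT, if_neg hji]
      exact hj
  have hnn : ∀ k : Fin d → ℤ, 0 ≤ actM η (fun i => x i - (k i : ℝ)) :=
    fun k => actM_nonneg_aux hm _
  calc ∑ k ∈ F, actM η (fun i => x i - (k i : ℝ))
      ≤ ∑ k ∈ Finset.univ.biUnion (fun i => Fintype.piFinset (T i)),
          actM η (fun i => x i - (k i : ℝ)) :=
        Finset.sum_le_sum_of_subset_of_nonneg hsub fun k _ _ => hnn k
    _ ≤ ∑ i, ∑ k ∈ Fintype.piFinset (T i), actM η (fun i => x i - (k i : ℝ)) := by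
        have key : ∀ U : Finset (Fin d), ∑ k ∈ U.biUnion (fun i => Fintype.piFinset (T i)),
            actM η (fun i => x i - (k i : ℝ)) ≤
            ∑ i ∈ U, ∑ k ∈ Fintype.piFinset (T i), actM η (fun i => x i - (k i : ℝ)) := by
          intro U
          induction U using Finset.induction_on with
          | empty => simp
          | insert a U ha ih =>
            rw [Finset.biUnion_insert, Finset.sum_insert ha]
            have h2 := Finset.sum_union_inter (s₁ := Fintype.piFinset (T a))
              (s₂ := U.biUnion (fun i => Fintype.piFinset (T i)))
              (f := fun k : Fin d → ℤ => actM η (fun i => x i - (k i : ℝ)))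
            have h3 := Finset.sum_nonneg (s := Fintype.piFinset (T a) ∩
              U.biUnion (fun i => Fintype.piFinset (T i)))
              (f := fun k : Fin d → ℤ => actM η (fun i => x i - (k i : ℝ)))
              (fun k _ => hnn k)
            linarith
        exact key Finset.univ
    _ ≤ ∑ _i : Fin d, (η (1 - R) + (1 - η (R - 1))) := by
        apply Finset.sum_le_sum
        intro i _
        unfold actM
        rw [← Finset.prod_univ_sum (T i) (fun j (k : ℤ) => act η (x j - (k : ℝ)))]
        rw [← Finset.mul_prod_erase Finset.univ _ (Finset.mem_univ i)]
        have e1 : ∑ k ∈ T i i, act η (x i - (k : ℝ)) ≤ η (1 - R) + (1 - η (R - 1)) := by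
          simp only [hT, if_true]
          exact act_sum_tail_aux hm h0 h1 (x i) R (S i)
        have e2 : ∏ j ∈ Finset.univ.erase i, ∑ k ∈ T i j, act η (x j - (k : ℝ)) ≤ 1 :=
          Finset.prod_le_one (fun j _ => Finset.sum_nonneg fun k _ => act_nonneg_aux hm _)
            (fun j _ => act_sum_le_one_aux hm h0 h1 _ _)
        have e3 : 0 ≤ ∑ k ∈ T i i, act η (x i - (k : ℝ)) :=
          Finset.sum_nonneg fun k _ => act_nonneg_aux hm _
        calc _ ≤ (∑ k ∈ T i i, act η (x i - (k : ℝ))) * 1 :=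
              mul_le_mul_of_nonneg_left e2 e3
          _ ≤ _ := by rw [mul_one]; exact e1
    _ = d * (η (1 - R) + (1 - η (R - 1))) := by simp; ring

theorem actM_localization
    (η : ℝ → ℝ)
    (hmono : Monotone η)
    (hmeas : Measurable η)
    (hbot : Tendsto η atBot (nhds 0))
    (htop : Tendsto η atTop (nhds 1))
    (hη1 : η 1 < 1)
    (hP1 : ∀ s : ℝ, η (-s) - 1 / 2 = -(η s - 1 / 2))
    (hP2 : ContDiff ℝ 2 η)
    (hP2' : ConcaveOn ℝ (Set.Ici 0) η)
    (hP3 : ∃ ρ : ℝ, 0 < ρ ∧ η =O[atBot] fun s : ℝ => |s| ^ (-1 - ρ))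
    (d : ℕ) (hd : 1 ≤ d) :
    ∀ δ : ℝ, 0 < δ →
      Tendsto (fun n : ℕ => ⨆ s : EuclideanSpace ℝ (Fin d),
          ∑' k : {k : Fin d → ℤ //
              (n : ℝ) * δ < ‖toEuc fun i => (n : ℝ) * s i - (k i : ℝ)‖},
            actM η (fun i => (n : ℝ) * s i - (k.1 i : ℝ))) atTop (nhds 0) := by
  intro δ hδ
  have h0 : ∀ x, 0 ≤ η x := fun x => hmono.le_of_tendsto hbot x
  have h1 : ∀ x, η x ≤ 1 := fun x => hmono.ge_of_tendsto htop x
  have hd' : (0 : ℝ) < d := by exact_mod_cast hd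
  have hε : ∀ R, 0 ≤ (d : ℝ) * (η (1 - R) + (1 - η (R - 1))) := fun R => by
    have := h0 (1 - R)
    have := h1 (R - 1)
    exact mul_nonneg hd'.le (by linarith)
  have hR : Tendsto (fun n : ℕ => (n : ℝ) * δ / d) atTop atTop :=
    (tendsto_natCast_atTop_atTop.atTop_mul_const hδ).atTop_div_const hd'
  have hlim : Tendsto (fun n : ℕ => (d : ℝ) *
      (η (1 - (n : ℝ) * δ / d) + (1 - η ((n : ℝ) * δ / d - 1)))) atTop (nhds 0) := by
    have ha : Tendsto (fun n : ℕ => 1 - (n : ℝ) * δ / d) atTop atBot :=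
      tendsto_const_nhds.add_atBot (tendsto_neg_atTop_atBot.comp hR)
    have hb : Tendsto (fun n : ℕ => (n : ℝ) * δ / d - 1) atTop atTop :=
      tendsto_atTop_add_const_right _ (-1) hR
    have := ((hbot.comp ha).add ((htop.comp hb).const_sub 1)).const_mul (d : ℝ)
    simpa using this
  refine squeeze_zero (fun n => Real.iSup_nonneg fun s => tsum_nonneg fun k =>
    actM_nonneg_aux hmono _) (fun n => ?_) hlim
  refine Real.iSup_le (fun s => ?_) (hε _)
  refine Real.tsum_le_of_sum_le (fun k => actM_nonneg_aux hmono _) (fun F => ?_)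
  have := actM_sum_aux hmono h0 h1 (fun i => (n : ℝ) * s i) ((n : ℝ) * δ / d)
    (F.map (Function.Embedding.subtype _)) (by
      intro k hk
      obtain ⟨k', _, rfl⟩ := Finset.mem_map.1 hk
      exact exists_coord_aux hd _ _ k'.2)
  rw [Finset.sum_map] at this
  exact this
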